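/- Cross-world identification under full mediation (Section 5). Let X : Ω → χ (a fully observed mediator), L₁⁽¹⁾ : Ω → α (the counterfactual first measurement under R₁ = 1), L₂⁰ : Ω → β (the counterfactual second measurement L₂^{(r₂=1, r₁=0)}), and R₁, R₂ : Ω → Bool be random variables with finite value types. Assume: (i) full mediation, L₁⁽¹⁾ ⊥ L₂⁰ | X; (ii) L₁⁽¹⁾ ⊥ R₁ | X; (iii) L₂⁰ ⊥ (R₁, R₂) | X; and positivity: for every x with P(X = x) > 0, both P(X = x, R₁ = 1) > 0 and P(X = x, R₁ = 0, R₂ = 1) > 0. Let L₁ be any random variable with L₁ = L₁⁽¹⁾ on the event {R₁ = 1}, and L₂ any random variable with L₂ = L₂⁰ on the event {R₁ = 0, R₂ = 1} (the observed proxies, by consistency). Then for all l₁ ∈ α, l₂ ∈ β: P(L₁⁽¹⁾ = l₁, L₂⁰ = l₂) = Σ_{x : P(X=x)>0} P(L₁ = l₁ | X = x, R₁ = 1) · P(L₂ = l₂ | X = x, R₁ = 0, R₂ = 1) · P(X = x). -/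

import Mathlib

open scoped BigOperators Classical

/-- Probability of the event `A` under the (finitely supported) law `P`. -/
noncomputable def Pr {Ω : Type*} [Fintype Ω] (P : Ω → ℝ) (A : Set Ω) : ℝ :=
  ∑ ω, A.indicator P ω

/-- Conditional probability `P(A | B) = P(A ∩ B) / P(B)`. -/
noncomputable def cPr {Ω : Type*} [Fintype Ω] (P : Ω → ℝ) (A B : Set Ω) : ℝ :=
  Pr P (A ∩ B) / Pr P B

theorem Pr_nonneg {Ω : Type*} [Fintype Ω] {P : Ω → ℝ} (hP : ∀ ω, 0 ≤ P ω) (A : Set Ω) :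
    0 ≤ Pr P A :=
  Finset.sum_nonneg fun ω _ => Set.indicator_nonneg (fun ω _ => hP ω) ω

theorem Pr_mono {Ω : Type*} [Fintype Ω] {P : Ω → ℝ} (hP : ∀ ω, 0 ≤ P ω) {A B : Set Ω}
    (h : A ⊆ B) : Pr P A ≤ Pr P B :=
  Finset.sum_le_sum fun ω _ => Set.indicator_le_indicator_of_subset h hP ω

theorem Pr_eq_sum_fiber {Ω χ : Type*} [Fintype Ω] [Fintype χ] (P : Ω → ℝ) (X : Ω → χ)
    (A : Set Ω) : Pr P A = ∑ x, Pr P (A ∩ {ω | X ω = x}) := by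
  unfold Pr
  rw [Finset.sum_comm]
  refine Finset.sum_congr rfl fun ω _ => ?_
  by_cases h : ω ∈ A <;> simp [Set.indicator_apply, h]

/-- The law of total probability over the values of `X` of positive probability. -/
theorem Pr_eq_sum_cPr_mul {Ω χ : Type*} [Fintype Ω] [Fintype χ] {P : Ω → ℝ}
    (hP : ∀ ω, 0 ≤ P ω) (X : Ω → χ) (A : Set Ω) :
    Pr P A = ∑ x ∈ Finset.univ.filter (fun x : χ => 0 < Pr P {ω | X ω = x}),
      cPr P A {ω | X ω = x} * Pr P {ω | X ω = x} := by
  rw [Pr_eq_sum_fiber P X A, Finset.sum_filter]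
  refine Finset.sum_congr rfl fun x _ => ?_
  split_ifs with hx
  · exact (div_mul_cancel₀ _ hx.ne').symm
  · exact le_antisymm ((Pr_mono hP Set.inter_subset_right).trans (not_lt.mp hx))
      (Pr_nonneg hP _)

theorem cPr_congr_left {Ω : Type*} [Fintype Ω] (P : Ω → ℝ) {A A' B : Set Ω}
    (h : ∀ ω ∈ B, ω ∈ A ↔ ω ∈ A') : cPr P A B = cPr P A' B := by
  have hAB : A ∩ B = A' ∩ B := Set.ext fun ω => and_congr_left (h ω)
  rw [cPr, cPr, hAB]

/-- Conditioning further on an event `C` that is independent of `A` given `B` changes nothing. -/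
theorem cPr_inter_right_of_indep {Ω : Type*} [Fintype Ω] {P : Ω → ℝ} {A B C : Set Ω}
    (hB : 0 < Pr P B) (hBC : 0 < Pr P (B ∩ C))
    (h : cPr P (A ∩ C) B = cPr P A B * cPr P C B) : cPr P A (B ∩ C) = cPr P A B := by
  unfold cPr at *
  rw [Set.inter_comm C B, Set.inter_assoc, Set.inter_comm C B] at h
  have hB' := hB.ne'
  have hBC' := hBC.ne'
  rw [div_eq_iff hBC']
  rw [div_eq_iff hB'] at h
  rw [h]
  field_simp

/-- Cross-world identification under full mediation (Section 5):
under full mediation `L₁⁽¹⁾ ⊥ L₂⁰ | X`, the ignorability conditions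
`L₁⁽¹⁾ ⊥ R₁ | X` and `L₂⁰ ⊥ (R₁, R₂) | X`, positivity, and consistency for the
observed proxies `L₁`, `L₂`, the cross-world joint law is identified as
`P(L₁⁽¹⁾=l₁, L₂⁰=l₂) = Σ_x P(L₁=l₁ | X=x, R₁=1) · P(L₂=l₂ | X=x, R₁=0, R₂=1) · P(X=x)`. -/
theorem stmt_10 {Ω χ α β : Type*} [Fintype Ω] [Fintype χ] [Fintype α] [Fintype β]
    [Nonempty χ] [Nonempty α] [Nonempty β]
    (P : Ω → ℝ) (hP : ∀ ω, 0 ≤ P ω) (hPsum : ∑ ω, P ω = 1)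
    (X : Ω → χ) (L₁full : Ω → α) (L₂zero : Ω → β) (R₁ R₂ : Ω → Bool)
    (L₁ : Ω → α) (L₂ : Ω → β)
    (hmed : ∀ x : χ, 0 < Pr P {ω | X ω = x} → ∀ (l₁ : α) (l₂ : β),
      cPr P {ω | L₁full ω = l₁ ∧ L₂zero ω = l₂} {ω | X ω = x}
        = cPr P {ω | L₁full ω = l₁} {ω | X ω = x}
          * cPr P {ω | L₂zero ω = l₂} {ω | X ω = x})
    (hig₁ : ∀ x : χ, 0 < Pr P {ω | X ω = x} → ∀ (l₁ : α) (b : Bool),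
      cPr P {ω | L₁full ω = l₁ ∧ R₁ ω = b} {ω | X ω = x}
        = cPr P {ω | L₁full ω = l₁} {ω | X ω = x}
          * cPr P {ω | R₁ ω = b} {ω | X ω = x})
    (hig₂ : ∀ x : χ, 0 < Pr P {ω | X ω = x} → ∀ (l₂ : β) (b₁ b₂ : Bool),
      cPr P {ω | L₂zero ω = l₂ ∧ R₁ ω = b₁ ∧ R₂ ω = b₂} {ω | X ω = x}
        = cPr P {ω | L₂zero ω = l₂} {ω | X ω = x}
          * cPr P {ω | R₁ ω = b₁ ∧ R₂ ω = b₂} {ω | X ω = x})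
    (hpos₁ : ∀ x : χ, 0 < Pr P {ω | X ω = x} →
      0 < Pr P {ω | X ω = x ∧ R₁ ω = true})
    (hpos₂ : ∀ x : χ, 0 < Pr P {ω | X ω = x} →
      0 < Pr P {ω | X ω = x ∧ R₁ ω = false ∧ R₂ ω = true})
    (hcons₁ : ∀ ω, R₁ ω = true → L₁ ω = L₁full ω)
    (hcons₂ : ∀ ω, R₁ ω = false → R₂ ω = true → L₂ ω = L₂zero ω) :
    ∀ (l₁ : α) (l₂ : β),
      Pr P {ω | L₁full ω = l₁ ∧ L₂zero ω = l₂}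
        = ∑ x ∈ Finset.univ.filter (fun x : χ => 0 < Pr P {ω | X ω = x}),
            cPr P {ω | L₁ ω = l₁} {ω | X ω = x ∧ R₁ ω = true}
              * cPr P {ω | L₂ ω = l₂} {ω | X ω = x ∧ R₁ ω = false ∧ R₂ ω = true}
              * Pr P {ω | X ω = x} := by
  intro l₁ l₂
  rw [Pr_eq_sum_cPr_mul hP X]
  refine Finset.sum_congr rfl fun x hx => ?_
  have hx : 0 < Pr P {ω | X ω = x} := (Finset.mem_filter.mp hx).2
  have h₁ : cPr P {ω | L₁ ω = l₁} {ω | X ω = x ∧ R₁ ω = true}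
      = cPr P {ω | L₁full ω = l₁} {ω | X ω = x} :=
    (cPr_congr_left P fun ω hω => by simp [hcons₁ ω hω.2]).trans
      (cPr_inter_right_of_indep hx (hpos₁ x hx) (hig₁ x hx l₁ true))
  have h₂ : cPr P {ω | L₂ ω = l₂} {ω | X ω = x ∧ R₁ ω = false ∧ R₂ ω = true}
      = cPr P {ω | L₂zero ω = l₂} {ω | X ω = x} :=
    (cPr_congr_left P fun ω hω => by simp [hcons₂ ω hω.2.1 hω.2.2]).trans
      (cPr_inter_right_of_indep hx (hpos₂ x hx) (hig₂ x hx l₂ false true))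
  rw [hmed x hx, h₁, h₂]
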